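/- arXiv:2006.10689 — 2 statements merged into one kernel-verified Lean document; each statement's English description precedes it below -/
import Mathlib

section
/- Fix a constant δ > 0 and suppose n ≥ n₀(δ) and k' ≤ n^{1−δ}. Let L₁, L₂ satisfy max{1/2, 2e·k·(k'/n)^{1−δ}} ≤ L₁ ≤ L₂ ≤ (1/2)·min{k, k'}, and set B₁ = (log 2 / 16)·k/(λL₁). Then for any 0 ≤ β ≤ B₁ there exists ℓ with L₁ ≤ ℓ ≤ L₂ such that with probability at least 1 − 2^{−(ℓ−2)/2} over W ∼ GOE(n), D_{β,ℓ} ≥ (log 2 / 4)·min{(log 2 / 16)·k/(βλ), L₂} − log 2. -/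
open MeasureTheory ProbabilityTheory Filter Asymptotics

noncomputable def goeMeasure (n : ℕ) : Measure (Fin n → Fin n → ℝ) :=
  Measure.map (fun g i j => g (min i j, max i j))
    (Measure.pi fun p : Fin n × Fin n =>
      gaussianReal 0 (if p.1 = p.2 then 2 / (n : NNReal) else 1 / (n : NNReal)))

noncomputable def quadForm {n : ℕ} (Y : Fin n → Fin n → ℝ) (S : Finset (Fin n)) : ℝ :=
  ∑ i ∈ S, ∑ j ∈ S, Y i j

noncomputable def Ymat {n : ℕ} (k : ℕ) (lam : ℝ) (x : Finset (Fin n))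
    (W : Fin n → Fin n → ℝ) : Fin n → Fin n → ℝ :=
  fun i j => lam / k * ((if i ∈ x then (1 : ℝ) else 0) * (if j ∈ x then (1 : ℝ) else 0)) + W i j

open Classical in
noncomputable def regionSum {n : ℕ} (k' : ℕ) (β : ℝ) (Y : Fin n → Fin n → ℝ)
    (P : Finset (Fin n) → Prop) : ℝ :=
  ∑ S ∈ Finset.univ.filter (fun S : Finset (Fin n) => S.card = k' ∧ P S),
    Real.exp (β * quadForm Y S)

noncomputable def gibbsProb {n : ℕ} (k' : ℕ) (β : ℝ) (Y : Fin n → Fin n → ℝ)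
    (P : Finset (Fin n) → Prop) : ℝ :=
  regionSum k' β Y P / regionSum k' β Y fun _ => True

noncomputable def FEWdepthY {n : ℕ} (k' : ℕ) (β ℓ : ℝ) (x : Finset (Fin n))
    (Y : Fin n → Fin n → ℝ) : ℝ :=
  Real.log (gibbsProb k' β Y fun S => ((x ∩ S).card : ℝ) < ℓ) -
    Real.log (gibbsProb k' β Y fun S => ℓ ≤ ((x ∩ S).card : ℝ) ∧ ((x ∩ S).card : ℝ) ≤ 2 * ℓ)

noncomputable def FEWdepth {n : ℕ} (k k' : ℕ) (lam β ℓ : ℝ) (x : Finset (Fin n))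
    (W : Fin n → Fin n → ℝ) : ℝ :=
  FEWdepthY k' β ℓ x (Ymat k lam x W)

noncomputable def phiVal {n : ℕ} (k' ℓ : ℕ) (Y : Fin n → Fin n → ℝ) (x : Finset (Fin n)) : ℝ :=
  sInf {r : ℝ | ∃ S : Finset (Fin n), S.card = k' ∧ (x ∩ S).card = ℓ ∧ r = -quadForm Y S}

noncomputable def gammaCurve (n k k' : ℕ) (lam : ℝ) (ℓ : ℕ) : ℝ :=
  -(lam * (ℓ : ℝ) ^ 2 / k) -
    2 * k' * Real.sqrt (1 / (n : ℝ) *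
      Real.log ((k.choose ℓ : ℝ) * ((n - k).choose (k' - ℓ) : ℝ)))

noncomputable def ellCrit (n k k' : ℕ) (lam : ℝ) : ℝ :=
  1 / (2 * lam) * k * Real.sqrt ((k' : ℝ) / ((n : ℝ) * Real.log ((n : ℝ) / (k' : ℝ)))) *
    Real.log (1 / (2 * lam) * Real.sqrt ((n : ℝ) / ((k' : ℝ) * Real.log ((n : ℝ) / (k' : ℝ)))))

def AssumLambda (k : ℕ → ℕ) (lam : ℕ → ℝ) : Prop :=
  ((fun n => (k n : ℝ) / n * Real.log ((n : ℝ) / (k n : ℝ))) =o[atTop] lam) ∧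
    (lam =o[atTop] fun n => min 1 ((k n : ℝ) / (Real.sqrt n * Real.log n)))

def AssumKprime (k k' : ℕ → ℕ) (lam : ℕ → ℝ) : Prop :=
  ((fun n => (k n : ℝ) ^ 2 / (lam n ^ 2 * n) * (Real.log ((n : ℝ) / (k n : ℝ))) ^ 2 /
      Real.log (lam n * n / (k n * Real.log ((n : ℝ) / (k n : ℝ))))) =o[atTop]
    fun n => (k' n : ℝ)) ∧
  ((fun n => (k' n : ℝ)) =o[atTop] fun n => lam n ^ 2 * n / Real.log n ^ 3) ∧
  ((fun n => (k' n : ℝ)) =o[atTop]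
    fun n => ((k n : ℝ) ^ 2 * n / (lam n ^ 2 * Real.log n)) ^ ((1 : ℝ) / 3))

def hasOGP {n : ℕ} (k k' : ℕ) (Y : Fin n → Fin n → ℝ) (x : Finset (Fin n)) (ζ₁ ζ₂ : ℕ) : Prop :=
  ζ₁ ≤ min k k' ∧ ζ₂ ≤ min k k' ∧ ζ₁ + 2 < ζ₂ ∧
    ∃ r : ℝ,
      (∃ v w : Finset (Fin n), v.card = k' ∧ w.card = k' ∧
        (x ∩ v).card ≤ ζ₁ ∧ ζ₂ ≤ (x ∩ w).card ∧ -quadForm Y v ≤ r ∧ -quadForm Y w ≤ r) ∧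
      ∀ v : Finset (Fin n), v.card = k' → -quadForm Y v ≤ r →
        (x ∩ v).card ≤ ζ₁ ∨ ζ₂ ≤ (x ∩ v).card


noncomputable def Wof {n : ℕ} (g : Fin n × Fin n → ℝ) : Fin n → Fin n → ℝ :=
  fun i j => g (min i j, max i j)

lemma exists_tau {n : ℕ} (σ : Equiv.Perm (Fin n)) : ∃ τ : Equiv.Perm (Fin n × Fin n),
    (∀ p, (τ p).1 = (τ p).2 ↔ p.1 = p.2) ∧
    ∀ g i j, Wof g (σ i) (σ j) = Wof (g ∘ τ) i j := by
  let f : Fin n × Fin n → Fin n × Fin n := fun p =>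
    if p.1 ≤ p.2 then (min (σ p.1) (σ p.2), max (σ p.1) (σ p.2))
    else (max (σ p.1) (σ p.2), min (σ p.1) (σ p.2))
  have hσ : ∀ a b, σ a = σ b ↔ a = b := fun a b => σ.injective.eq_iff
  have hf : Function.Injective f := by
    rintro ⟨a, b⟩ ⟨c, d⟩ h
    have h1 := hσ a b
    have h2 := hσ c d
    have h3 := hσ a c
    have h4 := hσ a d
    have h5 := hσ b c
    have h6 := hσ b d
    simp only [f] at h
    simp only [Prod.mk.injEq]
    split_ifs at h <;> simp only [Prod.mk.injEq] at h <;> grind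
  refine ⟨Equiv.ofBijective f (Finite.injective_iff_bijective.mp hf), ?_, ?_⟩
  · rintro ⟨a, b⟩
    have h1 := hσ a b
    simp only [Equiv.ofBijective_apply, f]
    split_ifs <;> grind
  · intro g i j
    simp only [Wof, Function.comp, Equiv.ofBijective_apply, f]
    congr 1
    grind

noncomputable abbrev Pg (n : ℕ) : Measure (Fin n × Fin n → ℝ) :=
    (Measure.pi fun p : Fin n × Fin n =>
      gaussianReal 0 (if p.1 = p.2 then 2 / (n : NNReal) else 1 / (n : NNReal)))

lemma mp_tau {n : ℕ} (τ : Equiv.Perm (Fin n × Fin n)) (h : ∀ p, (τ p).1 = (τ p).2 ↔ p.1 = p.2) :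
    MeasurePreserving (fun g : Fin n × Fin n → ℝ => g ∘ τ) (Pg n) (Pg n) := by
  have := (measurePreserving_piCongrLeft (fun p : Fin n × Fin n =>
      gaussianReal 0 (if p.1 = p.2 then 2 / (n : NNReal) else 1 / (n : NNReal))) τ.symm)
  have e : (fun g : Fin n × Fin n → ℝ => g ∘ τ) =
      (MeasurableEquiv.piCongrLeft (fun _ : Fin n × Fin n => ℝ) τ.symm) := by
    ext g p
    have := Equiv.piCongrLeft_apply_apply (P := fun _ : Fin n × Fin n => ℝ) τ.symm g (τ p)
    rw [Equiv.symm_apply_apply] at this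
    exact this.symm
  have e2 : (Measure.pi fun p : Fin n × Fin n => (gaussianReal 0
      (if (τ.symm p).1 = (τ.symm p).2 then 2 / (n : NNReal) else 1 / (n : NNReal)))) = Pg n := by
    unfold Pg
    congr 1
    ext1 p
    have := h (τ.symm p)
    rw [Equiv.apply_symm_apply] at this
    simp only [this]
  rw [e2] at this
  rw [e]
  exact this

lemma tail_count {n : ℕ} (x : Finset (Fin n)) (k' m : ℕ) :
    ((Finset.univ.filter (fun S : Finset (Fin n) => S.card = k' ∧ m ≤ (x ∩ S).card)).card)
      ≤ x.card.choose m * (n - m).choose (k' - m) := by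
  classical
  have : Finset.univ.filter (fun S : Finset (Fin n) => S.card = k' ∧ m ≤ (x ∩ S).card) ⊆
    (x.powersetCard m).biUnion (fun T => ((Finset.univ \ T).powersetCard (k' - m)).image (fun U => T ∪ U)) := by
    intro S hS
    simp only [Finset.mem_filter, Finset.mem_univ, true_and] at hS
    obtain ⟨T, hT, hc⟩ := Finset.exists_subset_card_eq hS.2
    simp only [Finset.mem_biUnion, Finset.mem_powersetCard, Finset.mem_image]
    have hTS : T ⊆ S := hT.trans Finset.inter_subset_right
    refine ⟨T, ⟨hT.trans Finset.inter_subset_left, hc⟩, S \ T, ⟨by grind, ?_⟩, ?_⟩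
    · rw [Finset.card_sdiff_of_subset hTS, hS.1, hc]
    · exact Finset.union_sdiff_of_subset hTS
  refine (Finset.card_le_card this).trans ?_
  rw [← Finset.card_powersetCard m x]
  refine Finset.card_biUnion_le_card_mul _ _ _ ?_
  intro T hT
  refine Finset.card_image_le.trans ?_
  rw [Finset.mem_powersetCard] at hT
  rw [Finset.card_powersetCard, Finset.card_sdiff_of_subset (Finset.subset_univ _), hT.2, Finset.card_univ, Fintype.card_fin]

lemma choose_ratio (n k' m : ℕ) (hm : m ≤ k') (hk : k' ≤ n) :
    (((n - m).choose (k' - m) : ℕ) : ℝ) ≤ ((k' : ℝ) / n) ^ m * n.choose k' := by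
  induction m with
  | zero => simp
  | succ m ih =>
    have ih := ih (by omega)
    obtain ⟨a, rfl⟩ : ∃ a, k' = m + 1 + a := ⟨k' - (m+1), by omega⟩
    obtain ⟨b, rfl⟩ : ∃ b, n = m + 1 + a + b := ⟨n - (m+1+a), by omega⟩
    have e1 : m + 1 + a + b - m = a + b + 1 := by omega
    have e2 : m + 1 + a - m = a + 1 := by omega
    have e3 : m + 1 + a + b - (m + 1) = a + b := by omega
    have e4 : m + 1 + a - (m + 1) = a := by omega
    rw [e1, e2] at ih
    rw [e3, e4]
    have key := Nat.add_one_mul_choose_eq (a+b) a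
    have key' : ((a:ℝ)+b+1) * (a+b).choose a = (a+b+1).choose (a+1) * (a+1) := by exact_mod_cast key
    set N : ℝ := (((m + 1 + a + b : ℕ) : ℝ)) with hN
    set K : ℝ := (((m + 1 + a : ℕ) : ℝ)) with hK
    have hNpos : 0 < N := by rw [hN]; positivity
    have : ((a+b).choose a : ℝ) ≤ K / N * (a+b+1).choose (a+1) := by
      rw [div_mul_eq_mul_div, le_div_iff₀ hNpos]
      have hp : (0:ℝ) < a + b + 1 := by positivity
      have : (a+1) * N ≤ K * (a+b+1) := by
        rw [hN, hK]; push_cast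
        nlinarith [mul_nonneg (Nat.cast_nonneg (α := ℝ) m) (Nat.cast_nonneg (α := ℝ) b)]
      have h2 : ((a+b).choose a : ℝ) = (a+b+1).choose (a+1) * (a+1) / (a+b+1) := by
        rw [eq_div_iff hp.ne']; linarith
      rw [h2, div_mul_eq_mul_div, div_le_iff₀ hp]
      have hc : (0:ℝ) ≤ (a+b+1).choose (a+1) := by positivity
      nlinarith
    rw [pow_succ]
    calc _ ≤ _ := this
      _ ≤ K / N * ((K/N)^m * _) := by gcongr
      _ = _ := by ring

lemma tail_bound {n : ℕ} (x : Finset (Fin n)) (k' m : ℕ) (hm : 1 ≤ m) (hk : k' ≤ n) (hmk : m ≤ k') (hn : 0 < n)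
    (h : 2 * Real.exp 1 * x.card * (k' / n) ≤ m) :
    ((Finset.univ.filter (fun S : Finset (Fin n) => S.card = k' ∧ m ≤ (x ∩ S).card)).card : ℝ)
      ≤ (1/2)^m * n.choose k' := by
  have h1 := tail_count x k' m
  have h1' : ((Finset.univ.filter (fun S : Finset (Fin n) => S.card = k' ∧ m ≤ (x ∩ S).card)).card : ℝ) ≤ (x.card.choose m : ℝ) * ((n - m).choose (k' - m) : ℕ) := by exact_mod_cast h1
  have h2 := choose_ratio n k' m hmk hk
  have h3 : (x.card.choose m : ℝ) ≤ (x.card:ℝ)^m / m.factorial := Nat.choose_le_pow_div _ _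
  have h4 := Real.pow_div_factorial_le_exp (m:ℝ) (by positivity) m
  have hmp : (0:ℝ) < m := by exact_mod_cast hm
  have h5 : (1:ℝ) / m.factorial ≤ (Real.exp 1 / m)^m := by
    rw [div_pow, ← Real.exp_nat_mul, mul_one, div_le_div_iff₀ (by positivity) (by positivity)]
    rw [div_le_iff₀ (by positivity)] at h4
    linarith
  have hk0 : (0:ℝ) ≤ (k':ℝ)/n := by positivity
  calc _ ≤ _ := h1'
    _ ≤ ((x.card:ℝ)^m * (1 / m.factorial)) * (((k' : ℝ) / n) ^ m * n.choose k') := by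
      gcongr
      · rw [mul_one_div]; exact h3
    _ ≤ ((x.card:ℝ)^m * (Real.exp 1 / m)^m) * (((k' : ℝ) / n) ^ m * n.choose k') := by gcongr
    _ = (Real.exp 1 * x.card * (k'/n) / m)^m * n.choose k' := by
      rw [← mul_pow, ← mul_assoc, ← mul_pow]; congr 2; ring
    _ ≤ _ := by
      have h6 : Real.exp 1 * x.card * (k'/n) / m ≤ 1/2 := by
        rw [div_le_iff₀ hmp]; linarith
      exact mul_le_mul_of_nonneg_right (pow_le_pow_left₀ (by positivity) h6 m) (by positivity)

lemma quad_map {n : ℕ} (σ : Equiv.Perm (Fin n)) (Y : Fin n → Fin n → ℝ) (S : Finset (Fin n)) :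
    quadForm Y (S.map σ.toEmbedding) = quadForm (fun i j => Y (σ i) (σ j)) S := by
  simp [quadForm]

/-- Gibbs weight of a single set. -/
noncomputable def wt {n : ℕ} (k' : ℕ) (β : ℝ) (Y : Fin n → Fin n → ℝ) (S : Finset (Fin n)) : ℝ :=
  Real.exp (β * quadForm Y S) / regionSum k' β Y fun _ => True

lemma region_map {n : ℕ} (k' : ℕ) (β : ℝ) (σ : Equiv.Perm (Fin n)) (Y : Fin n → Fin n → ℝ) :
    (regionSum k' β (fun i j => Y (σ i) (σ j)) fun _ => True) = regionSum k' β Y fun _ => True := by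
  classical
  unfold regionSum
  refine Finset.sum_bij (fun S _ => S.map σ.toEmbedding) ?_ ?_ ?_ ?_
  · intro S hS; simpa using hS
  · intro S _ T _ h; exact Finset.map_injective _ h
  · intro S hS
    refine ⟨S.map σ.symm.toEmbedding, by simpa using hS, ?_⟩
    ext a; simp
  · intro S hS; rw [quad_map]

lemma wt_map {n : ℕ} (k' : ℕ) (β : ℝ) (σ : Equiv.Perm (Fin n)) (Y : Fin n → Fin n → ℝ) (S : Finset (Fin n)) :
    wt k' β Y (S.map σ.toEmbedding) = wt k' β (fun i j => Y (σ i) (σ j)) S := by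
  rw [wt, wt, quad_map, region_map]

lemma exists_perm {n : ℕ} (S T : Finset (Fin n)) (h : S.card = T.card) :
    ∃ σ : Equiv.Perm (Fin n), S.map σ.toEmbedding = T := by
  classical
  let e := Finset.equivOfCardEq h
  refine ⟨e.extendSubtype, ?_⟩
  refine Finset.eq_of_subset_of_card_le ?_ (by simp [h])
  intro a ha
  rw [Finset.mem_map] at ha
  obtain ⟨b, hb, rfl⟩ := ha
  exact e.extendSubtype_mem b hb

lemma measurable_Wof {n : ℕ} : Measurable (fun g : Fin n × Fin n → ℝ => Wof g) := by
  unfold Wof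
  fun_prop

lemma measurable_quad {n : ℕ} (S : Finset (Fin n)) : Measurable (fun g : Fin n × Fin n → ℝ => quadForm (Wof g) S) := by
  unfold quadForm Wof
  fun_prop

lemma measurable_region {n : ℕ} (k' : ℕ) (β : ℝ) (P : Finset (Fin n) → Prop) :
    Measurable (fun g : Fin n × Fin n → ℝ => regionSum k' β (Wof g) P) := by
  unfold regionSum
  refine Finset.measurable_sum _ fun S _ => ?_
  exact ((measurable_quad S).const_mul β).exp

lemma measurable_wt {n : ℕ} (k' : ℕ) (β : ℝ) (S : Finset (Fin n)) :
    Measurable (fun g : Fin n × Fin n → ℝ => wt k' β (Wof g) S) := by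
  unfold wt
  exact ((measurable_quad S).const_mul β).exp.div (measurable_region _ _ _)

lemma region_pos {n : ℕ} (k' : ℕ) (β : ℝ) (Y : Fin n → Fin n → ℝ) (P : Finset (Fin n) → Prop)
    (h : ∃ S : Finset (Fin n), S.card = k' ∧ P S) : 0 < regionSum k' β Y P := by
  classical
  obtain ⟨S, hS⟩ := h
  unfold regionSum
  exact Finset.sum_pos (fun _ _ => Real.exp_pos _) ⟨S, by simpa using hS⟩

lemma region_nonneg {n : ℕ} (k' : ℕ) (β : ℝ) (Y : Fin n → Fin n → ℝ) (P : Finset (Fin n) → Prop) :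
    0 ≤ regionSum k' β Y P := by
  unfold regionSum
  exact Finset.sum_nonneg (fun _ _ => (Real.exp_pos _).le)

lemma wt_mem {n : ℕ} (k' : ℕ) (β : ℝ) (Y : Fin n → Fin n → ℝ) (S : Finset (Fin n)) (hS : S.card = k') :
    0 ≤ wt k' β Y S ∧ wt k' β Y S ≤ 1 := by
  classical
  refine ⟨div_nonneg (Real.exp_pos _).le (region_nonneg _ _ _ _), ?_⟩
  refine div_le_one_of_le₀ ?_ (region_nonneg _ _ _ _)
  unfold regionSum
  exact Finset.single_le_sum (f := fun S => Real.exp (β * quadForm Y S)) (fun _ _ => (Real.exp_pos _).le)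
    (by simpa using hS)

lemma integrable_wt {n : ℕ} (k' : ℕ) (β : ℝ) (S : Finset (Fin n)) (hS : S.card = k') :
    Integrable (fun g => wt k' β (Wof g) S) (Pg n) := by
  refine Integrable.of_bound (measurable_wt k' β S).aestronglyMeasurable 1 (ae_of_all _ fun g => ?_)
  have := wt_mem k' β (Wof g) S hS
  rw [Real.norm_eq_abs, abs_of_nonneg this.1]
  exact this.2

lemma integral_wt_eq {n : ℕ} (k' : ℕ) (β : ℝ) (S T : Finset (Fin n)) (h : S.card = T.card) :
    ∫ g, wt k' β (Wof g) S ∂(Pg n) = ∫ g, wt k' β (Wof g) T ∂(Pg n) := by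
  obtain ⟨σ, rfl⟩ := exists_perm S T h
  obtain ⟨τ, hτ, hW⟩ := exists_tau σ
  have mp := mp_tau τ hτ
  have : ∀ g, wt k' β (Wof g) (S.map σ.toEmbedding) = wt k' β (Wof (g ∘ τ)) S := by
    intro g
    rw [wt_map]
    congr 1
    ext i j
    exact hW g i j
  simp_rw [this]
  have h2 := integral_map (μ := Pg n) mp.measurable.aemeasurable
    (f := fun g => wt k' β (Wof g) S) (measurable_wt k' β S).aestronglyMeasurable
  rw [mp.map_eq] at h2
  exact h2

lemma integral_wt {n : ℕ} (k' : ℕ) (β : ℝ) (S : Finset (Fin n)) (h : S.card = k') :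
    ∫ g, wt k' β (Wof g) S ∂(Pg n) = 1 / (n.choose k' : ℝ) := by
  classical
  have hsum : ∀ g : Fin n × Fin n → ℝ, ∑ T ∈ (Finset.univ : Finset (Fin n)).powersetCard k', wt k' β (Wof g) T = 1 := by
    intro g
    have hp := region_pos k' β (Wof g) (fun _ => True) ⟨S, h, trivial⟩
    unfold wt
    rw [← Finset.sum_div, div_eq_one_iff_eq hp.ne']
    unfold regionSum
    refine Finset.sum_congr ?_ fun _ _ => rfl
    ext T; simp
  have h1 : ∫ g, ∑ T ∈ (Finset.univ : Finset (Fin n)).powersetCard k', wt k' β (Wof g) T ∂(Pg n) = 1 := by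
    simp_rw [hsum]; simp
  rw [integral_finsetSum _ (fun T hT => integrable_wt k' β T (Finset.mem_powersetCard.mp hT).2),
    Finset.sum_congr rfl (fun T hT => integral_wt_eq k' β T S ((Finset.mem_powersetCard.mp hT).2.trans h.symm))] at h1
  simp only [Finset.sum_const, Finset.card_powersetCard, Finset.card_univ, Fintype.card_fin, nsmul_eq_mul] at h1
  rw [eq_div_iff (by rintro h0; rw [h0] at h1; simp at h1)]
  linarith

lemma gibbs_eq_sum {n : ℕ} (k' : ℕ) (β : ℝ) (Y : Fin n → Fin n → ℝ) (P : Finset (Fin n) → Prop) [DecidablePred P] :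
    gibbsProb k' β Y P = ∑ S ∈ Finset.univ.filter (fun S : Finset (Fin n) => S.card = k' ∧ P S), wt k' β Y S := by
  unfold gibbsProb wt
  rw [← Finset.sum_div]
  congr 1
  unfold regionSum
  refine Finset.sum_congr ?_ fun _ _ => rfl
  ext; simp

lemma integral_gibbs {n : ℕ} (k' : ℕ) (β : ℝ) (P : Finset (Fin n) → Prop) [DecidablePred P] :
    Integrable (fun g => gibbsProb k' β (Wof g) P) (Pg n) ∧ ∫ g, gibbsProb k' β (Wof g) P ∂(Pg n) =
      (Finset.univ.filter (fun S : Finset (Fin n) => S.card = k' ∧ P S)).card / (n.choose k' : ℝ) := by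
  simp_rw [gibbs_eq_sum]
  have hi : ∀ S ∈ Finset.univ.filter (fun S : Finset (Fin n) => S.card = k' ∧ P S),
      Integrable (fun g => wt k' β (Wof g) S) (Pg n) :=
    fun S hS => integrable_wt k' β S (Finset.mem_filter.mp hS).2.1
  refine ⟨integrable_finsetSum _ hi, ?_⟩
  rw [integral_finsetSum _ hi, Finset.sum_congr rfl (fun S hS => integral_wt k' β S (Finset.mem_filter.mp hS).2.1)]
  simp [div_eq_mul_inv]

lemma quad_Ymat {n : ℕ} (k : ℕ) (lam : ℝ) (x S : Finset (Fin n)) (W : Fin n → Fin n → ℝ) :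
    quadForm (Ymat k lam x W) S = lam / k * ((x ∩ S).card : ℝ)^2 + quadForm W S := by
  classical
  unfold quadForm Ymat
  simp_rw [Finset.sum_add_distrib]
  congr 1
  simp_rw [← Finset.mul_sum]
  congr 1
  rw [← Finset.sum_mul]
  have : ∑ i ∈ S, (if i ∈ x then (1:ℝ) else 0) = (x ∩ S).card := by
    rw [Finset.sum_boole, Finset.filter_mem_eq_inter, Finset.inter_comm]
  rw [this]; ring

/-- The deterministic part. -/
lemma depth_bound {n : ℕ} (k k' : ℕ) (lam β ℓ : ℝ) (hl : 0 < lam) (hβ : 0 ≤ β) (hℓ : 0 < ℓ)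
    (x : Finset (Fin n)) (W : Fin n → Fin n → ℝ)
    (hB : ∃ S : Finset (Fin n), S.card = k' ∧ (ℓ ≤ ((x ∩ S).card : ℝ) ∧ ((x ∩ S).card : ℝ) ≤ 2 * ℓ))
    (hW : gibbsProb k' β W (fun S => ℓ ≤ ((x ∩ S).card : ℝ)) < 2 ^ (-(ℓ/2) - 1)) :
    ℓ / 2 * Real.log 2 - 4 * β * lam * ℓ^2 / k ≤ FEWdepth k k' lam β ℓ x W := by
  classical
  obtain ⟨S₀, hS₀, hS₀'⟩ := hB
  have hZ := region_pos k' β W (fun _ => True) ⟨S₀, hS₀, trivial⟩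
  have hZY := region_pos k' β (Ymat k lam x W) (fun _ => True) ⟨S₀, hS₀, trivial⟩
  have hBY := region_pos k' β (Ymat k lam x W) (fun S => ℓ ≤ ((x ∩ S).card : ℝ) ∧ ((x ∩ S).card : ℝ) ≤ 2 * ℓ) ⟨S₀, hS₀, hS₀'⟩
  rw [gibbsProb, div_lt_iff₀ hZ] at hW
  set Z := regionSum k' β W (fun _ => True)
  set ZB := regionSum k' β (Ymat k lam x W) (fun S => ℓ ≤ ((x ∩ S).card : ℝ) ∧ ((x ∩ S).card : ℝ) ≤ 2 * ℓ) with hZB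
  set ZA := regionSum k' β (Ymat k lam x W) (fun S => ((x ∩ S).card : ℝ) < ℓ) with hZA
  set t : ℝ := 2 ^ (-(ℓ/2) - 1) with ht
  have hsplit : regionSum k' β W (fun S => ((x ∩ S).card : ℝ) < ℓ) +
      regionSum k' β W (fun S => ℓ ≤ ((x ∩ S).card : ℝ)) = Z := by
    simp only [Z, regionSum]
    rw [← Finset.sum_union]
    · refine Finset.sum_congr ?_ fun _ _ => rfl
      ext S
      simp only [Finset.mem_union, Finset.mem_filter, Finset.mem_univ, true_and, and_true]
      have := lt_or_ge ((x ∩ S).card : ℝ) ℓ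
      tauto
    · rw [Finset.disjoint_left]
      intro S h1 h2
      simp only [Finset.mem_filter, Finset.mem_univ, true_and] at h1 h2
      linarith [h1.2, h2.2]
  have ht2 : t ≤ 1/2 := by
    have : t ≤ 2 ^ (-1 : ℝ) := Real.rpow_le_rpow_of_exponent_le (by norm_num) (by linarith)
    rw [Real.rpow_neg_one] at this
    linarith
  have hlk : 0 ≤ lam / k := by positivity
  have hA : regionSum k' β W (fun S => ((x ∩ S).card : ℝ) < ℓ) ≤ ZA := by
    simp only [hZA, regionSum]
    refine Finset.sum_le_sum fun S _ => ?_
    rw [quad_Ymat]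
    gcongr
    have : 0 ≤ lam / k * ((x ∩ S).card : ℝ)^2 := by positivity
    linarith
  have hBle : ZB ≤ Real.exp (4 * β * lam * ℓ^2 / k) * regionSum k' β W (fun S => ℓ ≤ ((x ∩ S).card : ℝ)) := by
    simp only [hZB, regionSum]
    rw [Finset.mul_sum]
    refine (Finset.sum_le_sum (g := fun S => Real.exp (4 * β * lam * ℓ^2 / k) * Real.exp (β * quadForm W S)) fun S hS => ?_).trans ?_
    · simp only [Finset.mem_filter, Finset.mem_univ, true_and] at hS
      rw [quad_Ymat, mul_add, Real.exp_add]
      gcongr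
      calc β * (lam / k * ((x ∩ S).card : ℝ)^2) ≤ β * (lam / k * (2 * ℓ)^2) := by
            gcongr; exact hS.2.2
        _ = _ := by ring
    · refine Finset.sum_le_sum_of_subset_of_nonneg ?_ fun _ _ _ => by positivity
      intro S hS
      simp only [Finset.mem_filter, Finset.mem_univ, true_and] at hS ⊢
      exact ⟨hS.1, hS.2.1⟩
  have hAZ : Z / 2 ≤ ZA := by nlinarith
  have hZApos : 0 < ZA := by linarith
  have hBZ : ZB ≤ Real.exp (4 * β * lam * ℓ^2 / k) * (t * Z) := by
    refine hBle.trans ?_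
    gcongr
  have htp : 0 < t := by positivity
  have hlogt : Real.log t = (-(ℓ/2) - 1) * Real.log 2 := Real.log_rpow (by norm_num) _
  have l1 : Real.log ZB ≤ 4 * β * lam * ℓ^2 / k + ((-(ℓ/2) - 1) * Real.log 2 + Real.log Z) := by
    have := Real.log_le_log hBY hBZ
    rwa [Real.log_mul (by positivity) (by positivity), Real.log_exp, Real.log_mul htp.ne' hZ.ne', hlogt] at this
  have l2 : Real.log Z - Real.log 2 ≤ Real.log ZA := by
    have := Real.log_le_log (by positivity) hAZ
    rwa [Real.log_div hZ.ne' (by norm_num)] at this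
  unfold FEWdepth FEWdepthY gibbsProb
  rw [Real.log_div hZApos.ne' hZY.ne', Real.log_div hBY.ne' hZY.ne']
  linarith

lemma exists_B {n : ℕ} (x : Finset (Fin n)) (k' m : ℕ) (h1 : m ≤ x.card) (h2 : m ≤ k')
    (h3 : x.card + k' ≤ n) : ∃ S : Finset (Fin n), S.card = k' ∧ (x ∩ S).card = m := by
  classical
  obtain ⟨T, hT, hTc⟩ := Finset.exists_subset_card_eq h1
  have hc : xᶜ.card = n - x.card := by rw [Finset.card_compl, Fintype.card_fin]
  obtain ⟨U, hU, hUc⟩ := Finset.exists_subset_card_eq (s := xᶜ) (n := k' - m) (by omega)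
  have hd : Disjoint x U := by
    rw [Finset.disjoint_left]; intro a ha hb; exact (Finset.mem_compl.mp (hU hb)) ha
  refine ⟨T ∪ U, ?_, ?_⟩
  · rw [Finset.card_union_of_disjoint (hd.mono_left hT)]; omega
  · rw [Finset.inter_union_distrib_left, Finset.disjoint_iff_inter_eq_empty.mp hd, Finset.union_empty,
      Finset.inter_eq_right.mpr hT, hTc]

lemma exists_nat_between (ℓ : ℝ) (h : 1/2 ≤ ℓ) : ∃ m : ℕ, ℓ ≤ m ∧ (m:ℝ) ≤ 2 * ℓ := by
  by_cases h1 : ℓ ≤ 1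
  · exact ⟨1, by simpa using h1, by push_cast; linarith⟩
  · exact ⟨⌈ℓ⌉₊, Nat.le_ceil _, by have := Nat.ceil_lt_add_one (a := ℓ) (by linarith); linarith⟩

lemma prob_bound {n : ℕ} (k k' : ℕ) (lam β ℓ : ℝ) (hl : 0 < lam) (hβ : 0 ≤ β) (hℓ : 1/2 ≤ ℓ)
    (x : Finset (Fin n)) (hx : x.card = k) (hn : 0 < n) (hkk : k + k' ≤ n)
    (hℓk : 2 * ℓ ≤ k) (hℓk' : 2 * ℓ ≤ k') (h2 : 2 * Real.exp 1 * k * ((k':ℝ) / n) ≤ ℓ)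
    (c : ℝ) (hc : c ≤ ℓ / 2 * Real.log 2 - 4 * β * lam * ℓ^2 / k) :
    ENNReal.ofReal (1 - (2 : ℝ) ^ (-(ℓ - 2) / 2)) ≤ goeMeasure n {W | c ≤ FEWdepth k k' lam β ℓ x W} := by
  classical
  set t : ℝ := 2 ^ (-(ℓ/2) - 1) with ht
  have htp : 0 < t := by positivity
  obtain ⟨m, hm1, hm2⟩ := exists_nat_between ℓ hℓ
  have hB : ∃ S : Finset (Fin n), S.card = k' ∧ (ℓ ≤ ((x ∩ S).card : ℝ) ∧ ((x ∩ S).card : ℝ) ≤ 2 * ℓ) := by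
    obtain ⟨S, h1, h2⟩ := exists_B x k' m (by rw [hx]; exact_mod_cast hm2.trans hℓk) (by exact_mod_cast hm2.trans hℓk') (by omega)
    exact ⟨S, h1, by rw [h2]; exact ⟨hm1, hm2⟩⟩
  set X : (Fin n × Fin n → ℝ) → ℝ := fun g => gibbsProb k' β (Wof g) (fun S => ℓ ≤ ((x ∩ S).card : ℝ)) with hX
  obtain ⟨hint, hE⟩ := integral_gibbs k' β (fun S : Finset (Fin n) => ℓ ≤ ((x ∩ S).card : ℝ))
  have hE2 : ∫ g, X g ∂(Pg n) ≤ 2 ^ (-ℓ) := by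
    rw [hX, hE]
    have hch : (0:ℝ) < n.choose k' := by exact_mod_cast Nat.choose_pos (by omega)
    rw [div_le_iff₀ hch]
    have hceil : ⌈ℓ⌉₊ ≤ m := Nat.ceil_le.mpr hm1
    have := tail_bound x k' ⌈ℓ⌉₊ (Nat.one_le_ceil_iff.mpr (by linarith)) (by omega)
      (hceil.trans (by exact_mod_cast hm2.trans hℓk')) hn (by rw [hx]; exact h2.trans (Nat.le_ceil _))
    simp_rw [Nat.ceil_le] at this
    refine this.trans ?_
    gcongr
    rw [← Real.rpow_natCast, one_div, Real.inv_rpow (by norm_num), ← Real.rpow_neg (by norm_num)]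
    exact Real.rpow_le_rpow_of_exponent_le (by norm_num) (by linarith [Nat.le_ceil ℓ])
  have hmark := mul_meas_ge_le_integral_of_nonneg (μ := Pg n) (f := X)
    (ae_of_all _ fun g => div_nonneg (region_nonneg _ _ _ _) (region_nonneg _ _ _ _)) hint t
  have hXm : Measurable X := (measurable_region _ _ _).div (measurable_region _ _ _)
  have hbad : (Pg n).real {g | t ≤ X g} ≤ 2 ^ (-(ℓ - 2) / 2) := by
    have e : (2:ℝ) ^ (-ℓ) = t * 2 ^ (-(ℓ - 2) / 2) := by
      rw [ht, ← Real.rpow_add (by norm_num)]; congr 1; ring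
    have h3 := hmark.trans hE2
    rw [e] at h3
    exact le_of_mul_le_mul_left h3 htp
  have hgood : 1 - (2:ℝ) ^ (-(ℓ - 2) / 2) ≤ (Pg n).real {g | X g < t} := by
    have : {g | X g < t} = {g | t ≤ X g}ᶜ := by ext g; simp
    rw [this, probReal_compl_eq_one_sub (measurableSet_le measurable_const hXm)]
    linarith
  calc _ ≤ ENNReal.ofReal ((Pg n).real {g | X g < t}) := ENNReal.ofReal_le_ofReal hgood
    _ = Pg n {g | X g < t} := ofReal_measureReal
    _ ≤ Pg n ((fun g => Wof g) ⁻¹' {W | c ≤ FEWdepth k k' lam β ℓ x W}) := by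
      refine measure_mono fun g hg => ?_
      exact hc.trans (depth_bound k k' lam β ℓ hl hβ (by linarith) x (Wof g) hB hg)
    _ ≤ _ := Measure.le_map_apply measurable_Wof.aemeasurable _

/-- Corollary: high-temperature depth bound with tuning window `[L₁, L₂]`.
Fix `δ > 0`; for `n ≥ n₀(δ)`, `k' ≤ n^{1-δ}`, `max{1/2, 2ek(k'/n)^{1-δ}} ≤ L₁ ≤ L₂ ≤ (1/2)min{k,k'}`,
`B₁ = (log 2/16)·k/(λL₁)`, and any `0 ≤ β ≤ B₁`, there exists `ℓ ∈ [L₁, L₂]` such that with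
probability at least `1 - 2^{-(ℓ-2)/2}` over `W ∼ GOE(n)`,
`D_{β,ℓ} ≥ (log 2/4)·min{(log 2/16)·k/(βλ), L₂} - log 2`. -/
theorem stmt_2 (δ : ℝ) (hδ : 0 < δ) :
    ∃ n₀ : ℕ, ∀ n : ℕ, n₀ ≤ n → ∀ k k' : ℕ, (k' : ℝ) ≤ (n : ℝ) ^ ((1 : ℝ) - δ) →
    ∀ x : Finset (Fin n), x.card = k → ∀ lam : ℝ, 0 < lam →
    ∀ L₁ L₂ : ℝ,
      max (1 / 2) (2 * Real.exp 1 * k * ((k' : ℝ) / n) ^ ((1 : ℝ) - δ)) ≤ L₁ →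
      L₁ ≤ L₂ → L₂ ≤ 1 / 2 * min (k : ℝ) (k' : ℝ) →
    ∀ β : ℝ, 0 ≤ β → β ≤ Real.log 2 / 16 * k / (lam * L₁) →
    ∃ ℓ : ℝ, L₁ ≤ ℓ ∧ ℓ ≤ L₂ ∧
      ENNReal.ofReal (1 - (2 : ℝ) ^ (-(ℓ - 2) / 2)) ≤
        goeMeasure n {W |
          Real.log 2 / 4 * min (Real.log 2 / 16 * k / (β * lam)) L₂ - Real.log 2 ≤
            FEWdepth k k' lam β ℓ x W} := by
  refine ⟨1, ?_⟩
  intro n hn k k' hk' x hx lam hl L₁ L₂ hL₁ hL hL₂ β hβ hβ₁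
  have hn0 : (0:ℝ) < n := by exact_mod_cast hn
  have hhalf : 1 / 2 ≤ L₁ := (le_max_left _ _).trans hL₁
  have hLk : 2 * L₂ ≤ k := by linarith [min_le_left (k:ℝ) (k':ℝ)]
  have hLk' : 2 * L₂ ≤ k' := by linarith [min_le_right (k:ℝ) (k':ℝ)]
  have hkpos : (0:ℝ) < k := by linarith
  have hkpos' : (0:ℝ) < k' := by linarith
  have hk'n : (k':ℝ) ≤ n := by
    refine hk'.trans ?_
    calc (n:ℝ) ^ ((1:ℝ) - δ) ≤ (n:ℝ) ^ (1:ℝ) :=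
          Real.rpow_le_rpow_of_exponent_le (by exact_mod_cast hn) (by linarith)
      _ = n := Real.rpow_one _
  have hq : (0:ℝ) < (k':ℝ) / n := by positivity
  have hq1 : (k':ℝ) / n ≤ 1 := by rw [div_le_one hn0]; exact hk'n
  have hqq : (k':ℝ) / n ≤ ((k':ℝ) / n) ^ ((1:ℝ) - δ) := by
    calc (k':ℝ) / n = ((k':ℝ) / n) ^ (1:ℝ) := (Real.rpow_one _).symm
      _ ≤ _ := Real.rpow_le_rpow_of_exponent_ge hq hq1 (by linarith)
  have hmain : 2 * Real.exp 1 * k * ((k':ℝ) / n) ≤ L₁ := by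
    refine le_trans ?_ ((le_max_right _ _).trans hL₁)
    gcongr
  have he : 2 ≤ Real.exp 1 := by linarith [Real.add_one_le_exp (1:ℝ)]
  have hmul : 2 * Real.exp 1 * (k * k') ≤ L₁ * n := by
    have := mul_le_mul_of_nonneg_right hmain hn0.le
    calc _ = 2 * Real.exp 1 * k * ((k':ℝ) / n) * n := by field_simp
      _ ≤ _ := this
  have hmul4 : 4 * ((k:ℝ) * k') ≤ L₁ * n := by
    refine le_trans ?_ hmul
    have : (0:ℝ) < k * k' := by positivity
    nlinarith
  have hkn : 8 * (k:ℝ) ≤ n := by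
    have : 4 * ((k:ℝ) * k') ≤ (k' / 2) * n := hmul4.trans (by gcongr; linarith)
    nlinarith
  have hkn' : 8 * (k':ℝ) ≤ n := by
    have : 4 * ((k:ℝ) * k') ≤ (k / 2) * n := hmul4.trans (by gcongr; linarith)
    nlinarith
  have hkk : k + k' ≤ n := by
    have : (k:ℝ) + k' ≤ n := by linarith
    exact_mod_cast this
  have hlog : 0 < Real.log 2 := Real.log_pos (by norm_num)
  have hfin : ∀ ℓ : ℝ, L₁ ≤ ℓ → ℓ ≤ L₂ →
      Real.log 2 / 4 * min (Real.log 2 / 16 * k / (β * lam)) L₂ - Real.log 2 ≤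
        ℓ / 2 * Real.log 2 - 4 * β * lam * ℓ ^ 2 / k →
      ∃ ℓ : ℝ, L₁ ≤ ℓ ∧ ℓ ≤ L₂ ∧
      ENNReal.ofReal (1 - (2 : ℝ) ^ (-(ℓ - 2) / 2)) ≤
        goeMeasure n {W |
          Real.log 2 / 4 * min (Real.log 2 / 16 * k / (β * lam)) L₂ - Real.log 2 ≤
            FEWdepth k k' lam β ℓ x W} := by
    intro ℓ h1 h2 h3
    exact ⟨ℓ, h1, h2, prob_bound k k' lam β ℓ hl hβ (by linarith) x hx hn hkk (by linarith)
      (by linarith) (by linarith) _ h3⟩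
  rcases hβ.eq_or_lt with h0 | hβpos
  · refine hfin L₂ hL le_rfl ?_
    subst h0
    have h1 : Real.log 2 / 4 * min (Real.log 2 / 16 * k / (0 * lam)) L₂ ≤ Real.log 2 / 4 * L₂ := by
      gcongr; exact min_le_right _ _
    have h2 : 0 < Real.log 2 * L₂ := mul_pos hlog (by linarith)
    have h3 : 4 * 0 * lam * L₂ ^ 2 / (k:ℝ) = 0 := by simp
    rw [h3]
    linarith
  · set M := min (Real.log 2 / 16 * k / (β * lam)) L₂ with hM
    have hL₁pos : 0 < L₁ := by linarith
    have hbl : 0 < β * lam := by positivity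
    have hM1 : L₁ ≤ M := by
      refine le_min ?_ hL
      rw [le_div_iff₀ hbl]
      rw [le_div_iff₀ (by positivity)] at hβ₁
      linarith
    refine hfin M hM1 (min_le_right _ _) ?_
    have h1 : M * (β * lam) ≤ Real.log 2 / 16 * k := by
      rw [← le_div_iff₀ hbl]; exact min_le_left _ _
    have hMpos : 0 < M := by linarith
    have h2 : 4 * β * lam * M ^ 2 / k ≤ Real.log 2 / 4 * M := by
      rw [div_le_iff₀ hkpos]
      nlinarith
    linarith
end

section
/- Under Assumptions (λ) and (k') with k, k' = o(n): for any 0 < δ₀ < δ₁ < 1 there exist a constant C > 10 and a constant D = D(δ₀, δ₁) > 0 (depending only on δ₀, δ₁) such that for sufficiently large n, for every δ ∈ (δ₀, δ₁): Γ_{k'}( ⌊(1−δ)·ℓ_c⌋ ) − D·(k'k)/(λn) ≥ max{ Γ_{k'}( ⌊k'k/n⌋ ), Γ_{k'}( C·⌈ℓ_c⌉ ) }. -/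
open MeasureTheory ProbabilityTheory Filter Asymptotics

noncomputable def wW (n k k' j : ℕ) : ℝ := (k.choose j : ℝ) * ((n - k).choose (k' - j) : ℝ)

lemma wW_pos {n k k' j : ℕ} (hj : j ≤ k) (hn : k + k' ≤ n) : 0 < wW n k k' j := by
  unfold wW
  have h1 := Nat.choose_pos hj
  have h2 : 0 < (n - k).choose (k' - j) := Nat.choose_pos (by omega)
  positivity

lemma wW_succ {n k k' j : ℕ} (hj : j < k) (hj' : j < k') (hn : k + k' ≤ n) :
    wW n k k' (j+1) * (((j:ℝ)+1) * ((n:ℝ) - k - k' + j + 1)) =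
      wW n k k' j * (((k:ℝ) - j) * ((k':ℝ) - j)) := by
  unfold wW
  obtain ⟨a, rfl⟩ : ∃ a, k = j + 1 + a := ⟨k - (j+1), by omega⟩
  obtain ⟨b, rfl⟩ : ∃ b, k' = j + 1 + b := ⟨k' - (j+1), by omega⟩
  obtain ⟨c, rfl⟩ : ∃ c, n = (j + 1 + a) + (j + 1 + b) + c := ⟨n - ((j + 1 + a) + (j + 1 + b)), by omega⟩
  have h1 := Nat.choose_succ_right_eq (j+1+a) j
  have h2 := Nat.choose_succ_right_eq (j+1+b+c) b
  have e1 : (j + 1 + a) + (j + 1 + b) + c - (j+1+a) = j+1+b+c := by omega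
  have e2 : j + 1 + b - (j+1) = b := by omega
  have e3 : j + 1 + b - j = b + 1 := by omega
  have e4 : j + 1 + a - j = a + 1 := by omega
  have e5 : j+1+b+c - b = j + 1 + c := by omega
  rw [e4] at h1
  rw [e5] at h2
  rw [e1, e2, e3]
  have h1' : (((j+1+a).choose (j+1) : ℕ) : ℝ) * (j+1) = ((j+1+a).choose j : ℕ) * (a+1) := by exact_mod_cast h1
  have h2' : (((j+1+b+c).choose (b+1) : ℕ) : ℝ) * (b+1) = ((j+1+b+c).choose b : ℕ) * (j+1+c) := by exact_mod_cast h2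
  push_cast
  linear_combination ((j+1+b+c).choose b : ℝ) * (j+1+c) * h1' - ((j+1+a).choose j : ℝ) * (a+1) * h2'

lemma wW_a {n k k' : ℕ} (hn : k + k' ≤ n) (l : ℕ) (hl : l ≤ k) (hl' : l ≤ k') :
    wW n k k' l * ((l.factorial : ℝ) * ((n:ℝ) - k - k') ^ l) ≤ wW n k k' 0 * ((k:ℝ) * k') ^ l := by
  induction l with
  | zero => simp
  | succ j ih =>
    have ih := ih (by omega) (by omega)
    have hs := wW_succ (n := n) (k := k) (k' := k') (j := j) (by omega) (by omega) hn
    have hp := wW_pos (n := n) (k := k) (k' := k') (j := j+1) (by omega) hn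
    have hp0 := wW_pos (n := n) (k := k) (k' := k') (j := j) (by omega) hn
    have hN : (0:ℝ) ≤ (n:ℝ) - k - k' := by
      have : (k:ℝ) + k' ≤ n := by exact_mod_cast hn
      linarith
    have hjk : (j:ℝ) + 1 ≤ k := by exact_mod_cast hl
    have hjk' : (j:ℝ) + 1 ≤ k' := by exact_mod_cast hl'
    have hj0 : (0:ℝ) ≤ j := by positivity
    have key : wW n k k' (j+1) * (((j:ℝ)+1) * ((n:ℝ) - k - k')) ≤ wW n k k' j * ((k:ℝ) * k') := by
      calc _ ≤ wW n k k' (j+1) * (((j:ℝ)+1) * ((n:ℝ) - k - k' + j + 1)) := by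
            gcongr; linarith
        _ = _ := hs
        _ ≤ _ := by
          gcongr <;> linarith
    rw [Nat.factorial_succ, pow_succ, pow_succ]
    push_cast
    calc _ = (wW n k k' (j+1) * (((j:ℝ)+1) * ((n:ℝ) - k - k'))) * ((j.factorial : ℝ) * ((n:ℝ) - k - k') ^ j) := by ring
      _ ≤ (wW n k k' j * ((k:ℝ) * k')) * ((j.factorial : ℝ) * ((n:ℝ) - k - k') ^ j) := by gcongr
      _ = (wW n k k' j * ((j.factorial : ℝ) * ((n:ℝ) - k - k') ^ j)) * ((k:ℝ) * k') := by ring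
      _ ≤ (wW n k k' 0 * ((k:ℝ) * k') ^ j) * ((k:ℝ) * k') := by gcongr
      _ = _ := by ring

lemma wW_b {n k k' : ℕ} (hn : k + k' ≤ n) (l : ℕ) (hl : l ≤ k) (hl' : l ≤ k') (hln : l * n ≤ k * k') :
    wW n k k' 0 ≤ wW n k k' l := by
  induction l with
  | zero => simp
  | succ j ih =>
    have ih := ih (by omega) (by omega) (le_trans (Nat.mul_le_mul_right _ (by omega)) hln)
    refine ih.trans ?_
    have hs := wW_succ (n := n) (k := k) (k' := k') (j := j) (by omega) (by omega) hn
    have hp := wW_pos (n := n) (k := k) (k' := k') (j := j+1) (by omega) hn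
    have hp0 := wW_pos (n := n) (k := k) (k' := k') (j := j) (by omega) hn
    have hN : (0:ℝ) ≤ (n:ℝ) - k - k' := by
      have : (k:ℝ) + k' ≤ n := by exact_mod_cast hn
      linarith
    have hjk : (j:ℝ) + 1 ≤ k := by exact_mod_cast hl
    have hjk' : (j:ℝ) + 1 ≤ k' := by exact_mod_cast hl'
    have hj0 : (0:ℝ) ≤ j := by positivity
    have hln' : ((j:ℝ)+1) * n ≤ k * k' := by exact_mod_cast hln
    have hD : 0 < ((j:ℝ)+1) * ((n:ℝ) - k - k' + j + 1) := by
      apply mul_pos <;> linarith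
    have hle : ((j:ℝ)+1) * ((n:ℝ) - k - k' + j + 1) ≤ ((k:ℝ) - j) * ((k':ℝ) - j) := by nlinarith
    refine le_of_mul_le_mul_right ?_ hD
    rw [hs]
    gcongr

lemma wW_c {n k k' l : ℕ} (hn : k + k' ≤ n) (hl : 2 * l ≤ k) (hl' : 2 * l ≤ k')
    (i m : ℕ) (him : i + m ≤ l) :
    wW n k k' i * ((k:ℝ) * k') ^ m ≤ wW n k k' (i + m) * (4 * (l:ℝ) * n) ^ m := by
  induction m with
  | zero => simp
  | succ m ih =>
    have ih := ih (by omega)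
    set j := i + m with hj
    have hs := wW_succ (n := n) (k := k) (k' := k') (j := j) (by omega) (by omega) hn
    have hp := wW_pos (n := n) (k := k) (k' := k') (j := j+1) (by omega) hn
    have hp0 := wW_pos (n := n) (k := k) (k' := k') (j := j) (by omega) hn
    have hN : (0:ℝ) ≤ (n:ℝ) - k - k' := by
      have : (k:ℝ) + k' ≤ n := by exact_mod_cast hn
      linarith
    have hjl : (j:ℝ) + 1 ≤ l := by exact_mod_cast (show j + 1 ≤ l by omega)
    have hlk : 2 * (l:ℝ) ≤ k := by exact_mod_cast hl
    have hlk' : 2 * (l:ℝ) ≤ k' := by exact_mod_cast hl'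
    have hj0 : (0:ℝ) ≤ j := by positivity
    have key : wW n k k' j * ((k:ℝ) * k') ≤ wW n k k' (j+1) * (4 * (l:ℝ) * n) := by
      have h1 : (k:ℝ) * k' ≤ 4 * (((k:ℝ) - j) * ((k':ℝ) - j)) := by
        have : ((k:ℝ)/2) * (k'/2) ≤ ((k:ℝ) - j) * ((k':ℝ) - j) := by gcongr <;> linarith
        linarith
      calc _ ≤ wW n k k' j * (4 * (((k:ℝ) - j) * ((k':ℝ) - j))) := by gcongr
        _ = 4 * (wW n k k' (j+1) * (((j:ℝ)+1) * ((n:ℝ) - k - k' + j + 1))) := by rw [hs]; ring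
        _ ≤ 4 * (wW n k k' (j+1) * ((l:ℝ) * n)) := by gcongr; linarith
        _ = _ := by ring
    have e : i + (m+1) = j + 1 := by omega
    rw [e, pow_succ, pow_succ]
    calc _ = (wW n k k' i * ((k:ℝ) * k') ^ m) * ((k:ℝ) * k') := by ring
      _ ≤ (wW n k k' j * (4 * (l:ℝ) * n) ^ m) * ((k:ℝ) * k') := by gcongr
      _ = (wW n k k' j * ((k:ℝ) * k')) * (4 * (l:ℝ) * n) ^ m := by ring
      _ ≤ (wW n k k' (j+1) * (4 * (l:ℝ) * n)) * (4 * (l:ℝ) * n) ^ m := by gcongr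
      _ = _ := by ring

lemma fact_lower (m : ℕ) : ((m:ℝ) / Real.exp 1) ^ m ≤ m.factorial := by
  have := Real.pow_div_factorial_le_exp (m:ℝ) (by positivity) m
  rw [div_pow, ← Real.exp_nat_mul, mul_one, div_le_iff₀ (by positivity)]
  rw [div_le_iff₀ (by positivity)] at this
  linarith

/-- log form of (a) and (b). -/
lemma log_a {n k k' l i : ℕ} (hn : k + k' ≤ n) (h2 : 2 * (k + k') ≤ n) (hk : 0 < k) (hk' : 0 < k') (hl0 : 0 < l)
    (hl : l ≤ k) (hl' : l ≤ k') (hi : i ≤ k) (hi' : i ≤ k') (hin : i * n ≤ k * k') :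
    (l:ℝ) * Real.log ((l:ℝ) * n / (2 * Real.exp 1 * (k * k'))) ≤
      Real.log (wW n k k' i) - Real.log (wW n k k' l) := by
  have ha := wW_a hn l hl hl'
  have hb := wW_b hn i hi hi' hin
  have hp := wW_pos (n := n) (k := k) (k' := k') (j := l) hl hn
  have hp0 := wW_pos (n := n) (k := k) (k' := k') (j := i) hi hn
  have hn2 : (n:ℝ)/2 ≤ (n:ℝ) - k - k' := by
    have : 2 * ((k:ℝ) + k') ≤ n := by exact_mod_cast h2
    linarith
  have hn0 : (0:ℝ) < n := by exact_mod_cast (by omega : 0 < n)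
  have hk0 : (0:ℝ) < k := by exact_mod_cast hk
  have hk0' : (0:ℝ) < k' := by exact_mod_cast hk'
  have hl00 : (0:ℝ) < l := by exact_mod_cast hl0
  have hf := fact_lower l
  rw [← Real.log_div hp0.ne' hp.ne', ← Real.log_pow]
  apply Real.log_le_log (by positivity)
  rw [le_div_iff₀ hp]
  have h3 : ((l:ℝ) * n / (2 * Real.exp 1 * (k * k'))) ^ l * ((k:ℝ) * k') ^ l = ((l:ℝ) / Real.exp 1) ^ l * ((n:ℝ)/2)^l := by
    rw [← mul_pow, ← mul_pow]; congr 1; field_simp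
  have hq : (0:ℝ) < ((k:ℝ) * k') ^ l := by positivity
  refine le_of_mul_le_mul_right ?_ hq
  calc _ = wW n k k' l * (((l:ℝ) / Real.exp 1) ^ l * ((n:ℝ)/2)^l) := by rw [← h3]; ring
    _ ≤ wW n k k' l * ((l.factorial : ℝ) * ((n:ℝ) - k - k') ^ l) := by gcongr
    _ ≤ _ := ha
    _ ≤ _ := by gcongr

lemma log_c {n k k' l i : ℕ} (hn : k + k' ≤ n) (hk : 0 < k) (hk' : 0 < k') (hl0 : 0 < l)
    (hl : 2 * l ≤ k) (hl' : 2 * l ≤ k') (hi : i ≤ l) (hbig : (1:ℝ) ≤ 4 * l * n / (k * k')) :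
    Real.log (wW n k k' i) - Real.log (wW n k k' l) ≤ (l:ℝ) * Real.log (4 * l * n / (k * k')) := by
  obtain ⟨m, rfl⟩ : ∃ m, l = i + m := ⟨l - i, by omega⟩
  have hc := wW_c hn hl hl' i m le_rfl
  have hp := wW_pos (n := n) (k := k) (k' := k') (j := i + m) (by omega) hn
  have hp0 := wW_pos (n := n) (k := k) (k' := k') (j := i) (by omega) hn
  have hk0 : (0:ℝ) < k := by exact_mod_cast hk
  have hk0' : (0:ℝ) < k' := by exact_mod_cast hk'
  have hlog := Real.log_nonneg hbig
  have : Real.log (wW n k k' i) - Real.log (wW n k k' (i+m)) ≤ (m:ℝ) * Real.log (4 * (i+m:ℕ) * n / (k * k')) := by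
    rw [← Real.log_div hp0.ne' hp.ne', ← Real.log_pow]
    apply Real.log_le_log (by positivity)
    rw [div_le_iff₀ hp, div_pow, div_mul_eq_mul_div, le_div_iff₀ (by positivity)]
    linarith
  refine this.trans ?_
  gcongr
  omega

lemma log_d {n k k' : ℕ} (h4 : 2 * (k + k') ≤ n) (hk' : 0 < k') :
    (k':ℝ) * (Real.log (n / k') - Real.log 2) ≤ Real.log (wW n k k' 0) := by
  have hk0' : (0:ℝ) < k' := by exact_mod_cast hk'
  have hn0 : (0:ℝ) < n := by exact_mod_cast (by omega : 0 < n)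
  rw [← Real.log_div (by positivity) (by norm_num), ← Real.log_pow]
  apply Real.log_le_log (by positivity)
  have h := Nat.pow_le_choose (α := ℝ) k' (n-k)
  have hf : (k'.factorial : ℝ) ≤ (k':ℝ)^k' := by exact_mod_cast Nat.factorial_le_pow k'
  simp only [wW, Nat.choose_zero_right, Nat.cast_one, one_mul, Nat.sub_zero]
  have h5 : (n:ℝ)/2 ≤ ((n - k + 1 - k' : ℕ) : ℝ) := by
    rw [div_le_iff₀ (by norm_num)]
    exact_mod_cast (by omega : n ≤ (n - k + 1 - k') * 2)
  have hkp : (0:ℝ) < (k':ℝ)^k' := by positivity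
  refine le_of_mul_le_mul_right ?_ hkp
  rw [← mul_pow]
  calc ((n:ℝ)/k'/2 * k')^k' = ((n:ℝ)/2)^k' := by congr 1; field_simp
    _ ≤ ((n - k + 1 - k' : ℕ) : ℝ)^k' := by gcongr
    _ ≤ ((n-k).choose k' : ℝ) * k'.factorial := (div_le_iff₀ (by positivity)).1 h
    _ ≤ _ := by gcongr

lemma log_e {n k k' i : ℕ} (hn : k + k' ≤ n) (hk' : 0 < k') (hi : i ≤ k) (hi' : i ≤ k') :
    Real.log (wW n k k' i) ≤ (k':ℝ) * (1 + Real.log (n / k')) := by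
  have hk0' : (0:ℝ) < k' := by exact_mod_cast hk'
  have hn0 : (0:ℝ) < n := by exact_mod_cast (by omega : 0 < n)
  have hp0 := wW_pos (n := n) (k := k) (k' := k') (j := i) hi hn
  have h1 : wW n k k' i ≤ (n.choose k' : ℝ) := by
    have := Nat.add_choose_eq k (n-k) k'
    rw [show k + (n-k) = n by omega] at this
    rw [this]
    unfold wW
    have h := Finset.single_le_sum (s := Finset.HasAntidiagonal.antidiagonal k') (f := fun ij : ℕ × ℕ => k.choose ij.1 * (n-k).choose ij.2) (fun _ _ => Nat.zero_le _) (a := (i, k'-i)) (by simp; omega)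
    exact_mod_cast h
  have h2 := Nat.choose_le_pow_div (α := ℝ) k' n
  have hf := fact_lower k'
  have h3 : wW n k k' i ≤ (Real.exp 1 * (n/k'))^k' := by
    refine h1.trans (h2.trans ?_)
    calc _ ≤ (n:ℝ)^k' / ((k':ℝ) / Real.exp 1) ^ k' := by gcongr
      _ = _ := by rw [← div_pow]; congr 1; field_simp
  have h4 := Real.log_le_log hp0 h3
  rwa [Real.log_pow, Real.log_mul (by positivity) (by positivity), Real.log_exp] at h4

lemma sqrt_up {a b d V : ℝ} (hV : 0 < V) (ha : V ^ 2 ≤ a) (hb : 0 ≤ b) (hd : 0 ≤ d) (h : a - b ≤ d) :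
    √a - √b ≤ d / V := by
  have hs : V ≤ √a := Real.le_sqrt_of_sq_le ha
  have ha0 : 0 ≤ a := (sq_nonneg V).trans ha
  rw [le_div_iff₀ hV]
  have h1 := Real.mul_self_sqrt ha0
  have h2 := Real.mul_self_sqrt hb
  rcases le_total (√a) (√b) with h | h
  · nlinarith
  · nlinarith [mul_le_mul_of_nonneg_right h (Real.sqrt_nonneg b), mul_nonneg (sub_nonneg.2 h) (sub_nonneg.2 hs)]

lemma sqrt_lo {a b d V : ℝ} (ha : 0 ≤ a) (hb : 0 ≤ b) (hd : 0 ≤ d) (h : d ≤ a - b) (hV : 0 < V) (haU : a ≤ V ^ 2) :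
    d / (2 * V) ≤ √a - √b := by
  rw [div_le_iff₀ (by positivity)]
  have h1 := Real.mul_self_sqrt ha
  have h2 := Real.mul_self_sqrt hb
  have h3 : √a ≤ V := Real.sqrt_le_iff.2 ⟨hV.le, haU⟩
  have h4 : √b ≤ √a := Real.sqrt_le_sqrt (by linarith)
  nlinarith [mul_nonneg (sub_nonneg.2 h4) (sub_nonneg.2 h3), mul_nonneg (sub_nonneg.2 h4) (sub_nonneg.2 h4)]

lemma wW_log_nonneg {n k k' j : ℕ} (hj : j ≤ k) (hn : k + k' ≤ n) : 0 ≤ Real.log (wW n k k' j) := by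
  apply Real.log_nonneg
  unfold wW
  have h1 := Nat.choose_pos hj
  have h2 : 0 < (n - k).choose (k' - j) := Nat.choose_pos (by omega)
  exact_mod_cast Nat.mul_pos h1 h2

lemma ell0_facts {n k k' : ℕ} (h2 : 2 * (k + k') ≤ n) (hk' : 0 < k') :
    (k' * k / n) * n ≤ k * k' ∧ k' * k / n ≤ k ∧ k' * k / n ≤ k' := by
  have hn : 0 < n := by omega
  refine ⟨?_, ?_, ?_⟩
  · rw [mul_comm k k']; exact Nat.div_mul_le_self _ _
  · apply Nat.div_le_of_le_mul
    exact Nat.mul_le_mul_right _ (by omega)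
  · apply Nat.div_le_of_le_mul
    rw [mul_comm]
    exact Nat.mul_le_mul_right _ (by omega)

lemma part1 {n k k' l : ℕ} {lam s q Lam M lc c : ℝ} (hk : 0 < k) (hk' : 0 < k')
    (h2 : 2 * (k + k') ≤ n) (hlam : 0 < lam) (hLam : Lam = Real.log (n / k')) (hL2 : 2 ≤ Lam)
    (hM : 0 < M) (hq : q = Real.log M) (hs : 0 < s) (hs2 : s ^ 2 * (n * Lam) = k')
    (hlc1 : lc = k / (2 * lam) * s * q) (hlc2 : lc = k * k' / n * M * q) (hc : 0 < c) (hq1 : 1 ≤ q)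
    (hcq : 2 * Real.exp 1 ≤ c * q) (hcq2 : 8 * Lam ≤ c * q ^ 2)
    (hl0 : 0 < l) (hlk : l ≤ k) (hlk' : l ≤ k') (hle : (l:ℝ) ≤ lc) (hge : c * lc ≤ l) :
    gammaCurve n k k' lam (k' * k / n) ≤ gammaCurve n k k' lam l - 1 * ((k':ℝ) * k / (lam * n)) := by
  obtain ⟨hi, hik, hik'⟩ := ell0_facts h2 hk'
  have hn : k + k' ≤ n := by omega
  set i := k' * k / n
  have hn0 : (0:ℝ) < n := by exact_mod_cast (by omega : 0 < n)
  have hk0 : (0:ℝ) < k := by exact_mod_cast hk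
  have hk0' : (0:ℝ) < k' := by exact_mod_cast hk'
  have hl00 : (0:ℝ) < l := by exact_mod_cast hl0
  have hA := log_a hn h2 hk hk' hl0 hlk hlk' hik hik' hi
  have hE := log_e hn hk' hik hik'
  have n1 := wW_log_nonneg (n := n) (k := k) (k' := k') hik hn
  have n2 := wW_log_nonneg (n := n) (k := k) (k' := k') hlk hn
  rw [← hLam] at hE
  have hB : q ≤ Real.log ((l:ℝ) * n / (2 * Real.exp 1 * (k * k'))) := by
    rw [hq]
    apply Real.log_le_log hM
    rw [le_div_iff₀ (by positivity)]
    have h3 : M * (2 * Real.exp 1 * (k * k')) ≤ M * (c * q * (k * k')) := by gcongr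
    have h4 : c * lc * n ≤ l * n := by gcongr
    have h5 : c * lc * n = M * (c * q * (k * k')) := by rw [hlc2]; field_simp
    linarith
  have hAB : (l:ℝ) * q ≤ Real.log (wW n k k' i) - Real.log (wW n k k' l) :=
    le_trans (by gcongr) hA
  have hV : 0 < 4 / 3 * k' / (n * s) := by positivity
  have hsq := sqrt_lo (a := 1 / (n:ℝ) * Real.log (wW n k k' i)) (b := 1 / (n:ℝ) * Real.log (wW n k k' l))
    (d := 1 / (n:ℝ) * (l * q)) (V := 4 / 3 * k' / (n * s)) (by positivity) (by positivity) (by positivity)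
    (by rw [← mul_sub]; gcongr) hV (by
      have e : (4 / 3 * (k':ℝ) / (n * s)) ^ 2 = 1 / (n:ℝ) * (k' * (16 / 9 * Lam)) := by
        field_simp
        rw [← hs2]; ring
      rw [e]
      gcongr
      refine hE.trans ?_
      gcongr
      linarith)
  have hd : 2 * (k':ℝ) * (1 / (n:ℝ) * (l * q) / (2 * (4 / 3 * k' / (n * s)))) = 3 / 4 * (l * s * q) := by
    field_simp
    try norm_num
  have hsq2 := mul_le_mul_of_nonneg_left hsq (by positivity : (0:ℝ) ≤ 2 * k')
  rw [hd] at hsq2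
  have hq2 : lam * (l:ℝ)^2 / k ≤ 1 / 2 * (l * s * q) := by
    have : lam * (l:ℝ)^2 / k ≤ lam * (l * lc) / k := by
      gcongr; rw [sq]; gcongr
    refine this.trans (le_of_eq ?_)
    rw [hlc1]; field_simp
  have hfin : (k':ℝ) * k / (lam * n) ≤ 1 / 4 * (l * s * q) := by
    have h3 : 1 / 4 * (c * lc * s * q) ≤ 1 / 4 * (l * s * q) := by gcongr
    refine le_trans ?_ h3
    have e : 1 / 4 * (c * lc * s * q) = (k * s ^ 2 / (8 * lam)) * (c * q ^ 2) := by
      rw [hlc1]; field_simp; norm_num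
    have e2 : (k':ℝ) * k / (lam * n) = (k * s ^ 2 / (8 * lam)) * (8 * Lam) := by
      rw [← hs2]; field_simp
    rw [e, e2]
    gcongr
  have hz : 0 ≤ lam * (i:ℝ)^2 / k := by positivity
  have g1 : gammaCurve n k k' lam i = -(lam * (i:ℝ)^2 / k) - 2 * k' * √(1 / (n:ℝ) * Real.log (wW n k k' i)) := rfl
  have g2 : gammaCurve n k k' lam l = -(lam * (l:ℝ)^2 / k) - 2 * k' * √(1 / (n:ℝ) * Real.log (wW n k k' l)) := rfl
  rw [g1, g2]
  linarith

lemma part2 {n k k' l : ℕ} {lam s q Lam M lc : ℝ} (hk : 0 < k) (hk' : 0 < k')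
    (h2 : 2 * (k + k') ≤ n) (hlam : 0 < lam) (hLam : Lam = Real.log (n / k')) (hL2 : 2 ≤ Lam)
    (hM : 0 < M) (hq : q = Real.log M) (hs : 0 < s) (hs2 : s ^ 2 * (n * Lam) = k')
    (hlc1 : lc = k / (2 * lam) * s * q) (hlc2 : lc = k * k' / n * M * q) (hq1 : 1600 ≤ q)
    (hl0 : 0 < l) (hlk : 2 * l ≤ k) (hlk' : 2 * l ≤ k') (hle : (l:ℝ) ≤ 200 * lc) (hge : 100 * lc ≤ l) :
    gammaCurve n k k' lam l ≤ gammaCurve n k k' lam (k' * k / n) := by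
  obtain ⟨hi, hik, hik'⟩ := ell0_facts h2 hk'
  have hn : k + k' ≤ n := by omega
  set i := k' * k / n
  have hn0 : (0:ℝ) < n := by exact_mod_cast (by omega : 0 < n)
  have hk0 : (0:ℝ) < k := by exact_mod_cast hk
  have hk0' : (0:ℝ) < k' := by exact_mod_cast hk'
  have hl00 : (0:ℝ) < l := by exact_mod_cast hl0
  have hMe : Real.exp q = M := by rw [hq, Real.exp_log hM]
  have hMq : 800 * q ≤ M := by
    rw [← hMe]
    have := Real.quadratic_le_exp_of_nonneg (by linarith : 0 ≤ q)
    nlinarith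
  have hM1 : 1 ≤ M := by linarith
  have hi2 : (i:ℝ) ≤ k * k' / n := by
    rw [le_div_iff₀ hn0]; exact_mod_cast hi
  have hkkn : 0 < (k:ℝ) * k' / n := by positivity
  have hilc : (k:ℝ) * k' / n ≤ lc := by
    rw [hlc2, mul_assoc]
    have : 1 ≤ M * q := by nlinarith
    nlinarith
  have hil : 100 * (i:ℝ) ≤ l := by linarith
  have hil' : i ≤ l := by
    have : (i:ℝ) ≤ l := by have : (0:ℝ) ≤ i := by positivity
                           linarith
    exact_mod_cast this
  have hx : 4 * (l:ℝ) * n / (k * k') ≤ M ^ 2 := by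
    rw [div_le_iff₀ (by positivity)]
    calc 4 * (l:ℝ) * n ≤ 4 * (200 * lc) * n := by gcongr
      _ = (800 * q) * (M * (k * k')) := by rw [hlc2]; field_simp; norm_num
      _ ≤ M * (M * (k * k')) := by gcongr
      _ = _ := by ring
  have hx1 : 1 ≤ 4 * (l:ℝ) * n / (k * k') := by
    rw [le_div_iff₀ (by positivity)]
    have := hilc
    rw [div_le_iff₀ hn0] at this
    have : lc * n ≤ l * n := by gcongr; linarith
    nlinarith
  have hC := log_c hn hk hk' hl0 hlk hlk' hil' hx1
  have hB : Real.log (4 * (l:ℝ) * n / (k * k')) ≤ 2 * q := by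
    have := Real.log_le_log (by linarith) hx
    rw [Real.log_pow, ← hq] at this
    exact_mod_cast this
  have hAB : Real.log (wW n k k' i) - Real.log (wW n k k' l) ≤ (l:ℝ) * (2 * q) :=
    hC.trans (by gcongr)
  have hE := log_d (k := k) h2 hk'
  rw [← hLam] at hE
  have hb := wW_b hn i hik hik' hi
  have hE2 := hE.trans (Real.log_le_log (wW_pos (Nat.zero_le _) hn) hb)
  have n1 := wW_log_nonneg (n := n) (k := k) (k' := k') hik hn
  have n2 := wW_log_nonneg (n := n) (k := k) (k' := k') (by omega : l ≤ k) hn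
  have hV : 0 < 1 / 2 * k' / (n * s) := by positivity
  have hsq := sqrt_up (a := 1 / (n:ℝ) * Real.log (wW n k k' i)) (b := 1 / (n:ℝ) * Real.log (wW n k k' l))
    (d := 1 / (n:ℝ) * (l * (2 * q))) (V := 1 / 2 * k' / (n * s)) hV (by
      have e : (1 / 2 * (k':ℝ) / (n * s)) ^ 2 = 1 / (n:ℝ) * (k' * (1 / 4 * Lam)) := by
        field_simp
        rw [← hs2]; ring
      rw [e]
      gcongr
      refine le_trans ?_ hE2
      gcongr
      have := Real.log_two_lt_d9
      linarith) (by positivity) (by positivity)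
    (by rw [← mul_sub]; gcongr)
  have hd : 2 * (k':ℝ) * (1 / (n:ℝ) * (l * (2 * q)) / (1 / 2 * k' / (n * s))) = 8 * (l * s * q) := by
    field_simp
    norm_num
  have hsq2 := mul_le_mul_of_nonneg_left hsq (by positivity : (0:ℝ) ≤ 2 * k')
  rw [hd] at hsq2
  have hq2 : 50 * (l * s * q) ≤ lam * (l:ℝ)^2 / k := by
    have : lam * (l * (100 * lc)) / k ≤ lam * (l:ℝ)^2 / k := by
      gcongr; rw [sq]; gcongr
    refine le_trans (le_of_eq ?_) this
    rw [hlc1]; field_simp; norm_num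
  have hz : lam * (i:ℝ)^2 / k ≤ 1 / 10000 * (lam * (l:ℝ)^2 / k) := by
    have : (i:ℝ)^2 ≤ (1/100 * l)^2 := by gcongr; linarith
    calc lam * (i:ℝ)^2 / k ≤ lam * (1/100 * l)^2 / k := by gcongr
      _ = _ := by ring
  have hpos : 0 ≤ l * s * q := by positivity
  have g1 : gammaCurve n k k' lam i = -(lam * (i:ℝ)^2 / k) - 2 * k' * √(1 / (n:ℝ) * Real.log (wW n k k' i)) := rfl
  have g2 : gammaCurve n k k' lam l = -(lam * (l:ℝ)^2 / k) - 2 * k' * √(1 / (n:ℝ) * Real.log (wW n k k' l)) := rfl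
  rw [g1, g2]
  linarith

set_option maxHeartbeats 2000000 in
lemma facts {n k k' : ℕ} {lam : ℝ} (hk : 0 < k) (hk' : 0 < k') (h2 : 2 * (k + k') ≤ n)
    (hlam : 0 < lam) (hlam2 : lam ≤ 1 / 2) (hR : 1 ≤ Real.log ((n:ℝ) / k))
    (hLn : 1 ≤ Real.log (n:ℝ))
    (hl1 : 2 * ((k:ℝ) / n * Real.log ((n:ℝ) / k)) ≤ lam)
    (hl2 : lam ≤ (k:ℝ) / (√n * Real.log n))
    (hK1 : 160000 * ((k : ℝ) ^ 2 / (lam ^ 2 * n) * (Real.log ((n : ℝ) / k)) ^ 2 /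
      Real.log (lam * n / (k * Real.log ((n : ℝ) / k)))) ≤ k')
    (hK2 : (k':ℝ) ≤ 1 / 160000 * (lam ^ 2 * n / Real.log n ^ 3))
    (hK3 : (k':ℝ) ≤ ((k : ℝ) ^ 2 * n / (lam ^ 2 * Real.log n)) ^ ((1 : ℝ) / 3))
    (hLam : 6400 ≤ Real.log ((n:ℝ) / k')) :
    ∃ s q M : ℝ, 0 < M ∧ q = Real.log M ∧ 0 < s ∧ s ^ 2 * (n * Real.log ((n:ℝ) / k')) = k' ∧
      ellCrit n k k' lam = k / (2 * lam) * s * q ∧ ellCrit n k k' lam = k * k' / n * M * q ∧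
      Real.log ((n:ℝ) / k') / 4 ≤ q ∧ 400 * ellCrit n k k' lam ≤ k ∧
      400 * ellCrit n k k' lam ≤ k' ∧ q / 2 ≤ ellCrit n k k' lam := by
  have hn0 : (0:ℝ) < n := by exact_mod_cast (by omega : 0 < n)
  have hk0 : (0:ℝ) < k := by exact_mod_cast hk
  have hk0' : (0:ℝ) < k' := by exact_mod_cast hk'
  have hk1 : (1:ℝ) ≤ k := by exact_mod_cast hk
  have hk1' : (1:ℝ) ≤ k' := by exact_mod_cast hk'
  obtain ⟨Lam, hLe⟩ : ∃ Lam, Lam = Real.log ((n:ℝ) / k') := ⟨_, rfl⟩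
  obtain ⟨R, hRe⟩ : ∃ R, R = Real.log ((n:ℝ) / k) := ⟨_, rfl⟩
  obtain ⟨N, hNe⟩ : ∃ N, N = Real.log (n:ℝ) := ⟨_, rfl⟩
  obtain ⟨s, hse⟩ : ∃ s, s = √((k' : ℝ) / ((n : ℝ) * Lam)) := ⟨_, rfl⟩
  obtain ⟨M, hMe⟩ : ∃ M, M = 1 / (2 * lam) * √((n : ℝ) / ((k' : ℝ) * Lam)) := ⟨_, rfl⟩
  rw [← hLe] at hLam
  rw [← hRe] at hl1 hK1 hR
  rw [← hNe] at hl2 hK2 hK3 hLn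
  have hL0 : 0 < Lam := by linarith
  have hs0 : 0 < s := by rw [hse]; positivity
  have hM0 : 0 < M := by rw [hMe]; positivity
  have hs2 : s ^ 2 * (n * Lam) = k' := by
    rw [hse, Real.sq_sqrt (by positivity)]; field_simp
  have hM2 : M ^ 2 = n / (4 * lam ^ 2 * k' * Lam) := by
    rw [hMe, mul_pow, Real.sq_sqrt (by positivity)]; field_simp; norm_num
  have hsM : s = 2 * lam * M * k' / n := by
    have : s ^ 2 = (2 * lam * M * k' / n) ^ 2 := by
      rw [div_pow, mul_pow, mul_pow, hM2, hse, Real.sq_sqrt (by positivity)]; field_simp; norm_num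
    exact (sq_eq_sq₀ hs0.le (by positivity)).1 this
  have hlc1 : ellCrit n k k' lam = k / (2 * lam) * s * Real.log M := by
    unfold ellCrit
    rw [← hLe, ← hse, ← hMe]; ring
  have hlc2 : ellCrit n k k' lam = k * k' / n * M * Real.log M := by
    rw [hlc1, hsM]; field_simp
  obtain ⟨q, hqe⟩ : ∃ q, q = Real.log M := ⟨_, rfl⟩
  rw [← hqe] at hlc1 hlc2
  have hLN : Lam ≤ N := by
    rw [hLe, hNe]
    exact Real.log_le_log (by positivity) (div_le_self hn0.le hk1')
  have hRN : R ≤ N := by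
    rw [hRe, hNe]
    exact Real.log_le_log (by positivity) (div_le_self hn0.le hk1)
  have hN0 : 0 < N := by linarith
  have hR0 : 0 < R := by linarith
  -- q lower bound
  have hq1 : Lam / 4 ≤ q := by
    have h1 : (n:ℝ) / (k' * Lam) ≤ M ^ 2 := by
      rw [hM2]
      apply div_le_div_of_nonneg_left hn0.le (by positivity)
      have : 4 * lam ^ 2 ≤ 1 := by nlinarith
      have : 4 * lam ^ 2 * (k' * Lam) ≤ 1 * (k' * Lam) := by gcongr
      linarith
    have h3 := Real.log_le_log (by positivity) h1
    rw [Real.log_pow, ← hqe, ← div_div, Real.log_div (by positivity) (by positivity), ← hLe] at h3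
    have h4 : Real.log Lam ≤ Lam / 2 := by
      have e : Real.log Lam = Real.log (Lam / 2) + Real.log 2 := by
        rw [← Real.log_mul (by positivity) (by norm_num)]; congr 1; ring
      have := Real.log_le_sub_one_of_pos (by positivity : 0 < Lam / 2)
      have := Real.log_two_lt_d9
      linarith
    push_cast at h3
    linarith
  have hq0 : 0 < q := by linarith
  -- M ≤ n / k / (400 R)
  have hMk : M ≤ n / (400 * k * R) := by
    have hA2 : 2 ≤ lam * n / (k * R) := by
      rw [le_div_iff₀ (by positivity)]
      have : 2 * ((k:ℝ) / n * R) * n ≤ lam * n := by gcongr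
      have e : 2 * ((k:ℝ) / n * R) * n = 2 * (k * R) := by field_simp
      linarith
    obtain ⟨A, hAe⟩ : ∃ A, A = lam * n / (k * R) := ⟨_, rfl⟩
    rw [← hAe] at hK1 hA2
    have hlA : 0 < Real.log A := Real.log_pos (by linarith)
    have hcub : A ^ 2 ≤ ((n:ℝ) / k') ^ 3 := by
      have h3 : (k':ℝ) ^ 3 ≤ (k : ℝ) ^ 2 * n / (lam ^ 2 * N) := by
        have h := pow_le_pow_left₀ hk0'.le hK3 3
        rw [← Real.rpow_natCast (_ ^ ((1:ℝ)/3)) 3, ← Real.rpow_mul (by positivity)] at h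
        norm_num at h
        exact h
      rw [hAe, div_pow, div_pow, div_le_div_iff₀ (by positivity) (by positivity)]
      calc (lam * n) ^ 2 * (k':ℝ) ^ 3 ≤ (lam * n) ^ 2 * ((k : ℝ) ^ 2 * n / (lam ^ 2 * N)) := by gcongr
        _ = (n:ℝ) ^ 3 * k ^ 2 / N := by field_simp
        _ ≤ (n:ℝ) ^ 3 * k ^ 2 / 1 := by gcongr
        _ ≤ (n:ℝ) ^ 3 * (k * R) ^ 2 := by
          rw [div_one, mul_pow]
          have : 1 ≤ R ^ 2 := by nlinarith
          have : (n:ℝ) ^ 3 * k ^ 2 * 1 ≤ (n:ℝ) ^ 3 * k ^ 2 * R ^ 2 := by gcongr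
          linarith
    have hLA : 2 * Real.log A ≤ 3 * Lam := by
      have := Real.log_le_log (by positivity) hcub
      rw [Real.log_pow, Real.log_pow, ← hLe] at this
      exact_mod_cast this
    have hsq : M ^ 2 ≤ (n / (400 * k * R)) ^ 2 := by
      have h5 : 160000 * ((k:ℝ) ^ 2 * R ^ 2) ≤ k' * (lam ^ 2 * n * Real.log A) := by
        have e : 160000 * ((k : ℝ) ^ 2 / (lam ^ 2 * n) * R ^ 2 / Real.log A) = 160000 * ((k:ℝ) ^ 2 * R ^ 2) / (lam ^ 2 * n * Real.log A) := by
          field_simp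
        rw [e, div_le_iff₀ (by positivity)] at hK1
        exact hK1
      rw [hM2, div_pow, div_le_div_iff₀ (by positivity) (by positivity)]
      calc (n:ℝ) * (400 * k * R) ^ 2 = n * (160000 * ((k:ℝ) ^ 2 * R ^ 2)) := by ring
        _ ≤ n * (k' * (lam ^ 2 * n * Real.log A)) := by gcongr
        _ ≤ n * (k' * (lam ^ 2 * n * (4 * Lam))) := by gcongr; linarith
        _ = _ := by ring
    exact (sq_le_sq₀ hM0.le (by positivity)).1 hsq
  have hqR : q ≤ R := by
    rw [hqe, hRe]
    apply Real.log_le_log hM0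
    refine hMk.trans ?_
    have h400 : (k:ℝ) * 1 ≤ k * (400 * R) := mul_le_mul_of_nonneg_left (by linarith) hk0.le
    apply div_le_div_of_nonneg_left hn0.le hk0
    linarith
  refine ⟨s, q, M, hM0, hqe, hs0, by rw [← hLe]; exact hs2, hlc1, hlc2, by rw [← hLe]; exact hq1, ?_, ?_, ?_⟩
  · -- ≤ k
    have hs3 : s ≤ lam / (400 * N) := by
      have : s ^ 2 ≤ (lam / (400 * N)) ^ 2 := by
        rw [hse, Real.sq_sqrt (by positivity), div_pow, div_le_div_iff₀ (by positivity) (by positivity)]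
        calc (k':ℝ) * (400 * N) ^ 2 ≤ 1 / 160000 * (lam ^ 2 * n / N ^ 3) * (400 * N) ^ 2 := by gcongr
          _ = lam ^ 2 * (n / N) := by field_simp; norm_num
          _ ≤ lam ^ 2 * (n * Lam) := by
            gcongr
            rw [div_le_iff₀ hN0, mul_assoc]
            have : 1 ≤ Lam * N := by nlinarith
            nlinarith
      exact (sq_le_sq₀ hs0.le (by positivity)).1 this
    rw [hlc1]
    calc 400 * (k / (2 * lam) * s * q) ≤ 400 * (k / (2 * lam) * (lam / (400 * N)) * N) := by
          gcongr; linarith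
      _ = k / 2 := by field_simp
      _ ≤ k := by linarith
  · rw [hlc2]
    calc 400 * ((k:ℝ) * k' / n * M * q) ≤ 400 * ((k:ℝ) * k' / n * (n / (400 * k * R)) * R) := by gcongr
      _ = k' := by field_simp
  · rw [hlc1]
    have hs4 : 1 / (√n * N) ≤ s := by
      have : (1 / (√(n:ℝ) * N)) ^ 2 ≤ s ^ 2 := by
        rw [hse, Real.sq_sqrt (by positivity), div_pow, mul_pow, Real.sq_sqrt hn0.le, div_le_div_iff₀ (by positivity) (by positivity)]
        have : Lam ≤ N ^ 2 := by nlinarith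
        calc (1:ℝ) ^ 2 * (n * Lam) ≤ 1 ^ 2 * (n * N ^ 2) := by gcongr
          _ ≤ k' * (n * N ^ 2) := by gcongr; linarith
      exact (sq_le_sq₀ (by positivity) hs0.le).1 this
    have hkl : √n * N ≤ k / lam := by
      rw [le_div_iff₀ hlam]
      rw [le_div_iff₀ (by positivity)] at hl2
      linarith
    calc q / 2 = (√n * N) * (1 / (√n * N)) * (q / 2) := by field_simp
      _ ≤ (k / lam) * s * (q / 2) := by gcongr
      _ = _ := by field_simp

set_option maxHeartbeats 2000000 in
/-- Theorem FM2, part (d): the gap in the first moment curve.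
Under Assumptions (λ) and (k') with `k, k' = o(n)`: for any `0 < δ₀ < δ₁ < 1` there exist a
constant `C > 10` and a constant `D = D(δ₀,δ₁) > 0` such that for sufficiently large `n`,
for every `δ ∈ (δ₀, δ₁)`:
`Γ_{k'}(⌊(1-δ)ℓ_c⌋) - D·(k'k)/(λn) ≥ max{Γ_{k'}(⌊k'k/n⌋), Γ_{k'}(C⌈ℓ_c⌉)}`. -/
theorem stmt_11 (k k' : ℕ → ℕ) (lam : ℕ → ℝ) (hlam : ∀ n, 0 < lam n)
    (hkle : ∀ n, k n ≤ n) (hk'le : ∀ n, k' n ≤ n)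
    (hkTop : Tendsto (fun n => k n) atTop atTop) (hk'Top : Tendsto (fun n => k' n) atTop atTop)
    (hko : (fun n => (k n : ℝ)) =o[atTop] fun n => (n : ℝ))
    (hk'o : (fun n => (k' n : ℝ)) =o[atTop] fun n => (n : ℝ))
    (hAL : AssumLambda k lam) (hAK : AssumKprime k k' lam)
    (δ₀ δ₁ : ℝ) (h0 : 0 < δ₀) (h01 : δ₀ < δ₁) (h11 : δ₁ < 1) :
    ∃ C : ℕ, 10 < C ∧ ∃ D : ℝ, 0 < D ∧
      ∀ᶠ n in atTop, ∀ δ : ℝ, δ₀ < δ → δ < δ₁ →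
        max (gammaCurve n (k n) (k' n) (lam n) (k' n * k n / n))
            (gammaCurve n (k n) (k' n) (lam n) (C * ⌈ellCrit n (k n) (k' n) (lam n)⌉₊)) ≤
          gammaCurve n (k n) (k' n) (lam n) ⌊(1 - δ) * ellCrit n (k n) (k' n) (lam n)⌋₊ -
            D * ((k' n : ℝ) * (k n : ℝ) / (lam n * n)) := by
  refine ⟨100, by norm_num, 1, one_pos, ?_⟩
  obtain ⟨hAL1, hAL2⟩ := hAL
  obtain ⟨hAK1, hAK2, hAK3⟩ := hAK
  set c : ℝ := (1 - δ₁) / 2 with hc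
  have hc0 : 0 < c := by rw [hc]; linarith
  set T : ℝ := max 6400 (128 / c) with hT
  have e1 := hAL1.bound (by norm_num : (0:ℝ) < 1 / 2)
  have e2 := hAL2.bound (by norm_num : (0:ℝ) < 1 / 2)
  have e3 := hAK1.bound (by norm_num : (0:ℝ) < 1 / 160000)
  have e4 := hAK2.bound (by norm_num : (0:ℝ) < 1 / 160000)
  have e5 := hAK3.bound (by norm_num : (0:ℝ) < 1)
  have e6 := hko.bound (by positivity : (0:ℝ) < Real.exp (-T))
  have e7 := hk'o.bound (by positivity : (0:ℝ) < Real.exp (-T))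
  have e8 := hkTop.eventually_ge_atTop 1
  have e9 := hk'Top.eventually_ge_atTop 1
  have e10 : ∀ᶠ n : ℕ in atTop, 1 ≤ Real.log (n:ℝ) :=
    (Real.tendsto_log_atTop.comp tendsto_natCast_atTop_atTop).eventually_ge_atTop 1
  filter_upwards [e1, e2, e3, e4, e5, e6, e7, e8, e9, e10, eventually_gt_atTop 0] with
    n e1 e2 e3 e4 e5 e6 e7 e8 e9 hLn hn δ hδ0 hδ1
  have hl := hlam n
  generalize k n = K at *
  generalize k' n = K' at *
  generalize lam n = L at *
  have hn0 : (0:ℝ) < n := by exact_mod_cast hn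
  have hk0 : (0:ℝ) < K := by exact_mod_cast e8
  have hk0' : (0:ℝ) < K' := by exact_mod_cast e9
  have hT1 : 6400 ≤ T := le_max_left _ _
  have hT2 : 128 / c ≤ T := le_max_right _ _
  have hlogT : ∀ x : ℝ, 0 < x → ‖x‖ ≤ Real.exp (-T) * ‖(n:ℝ)‖ → T ≤ Real.log (n / x) := by
    intro x hx h
    rw [Real.norm_of_nonneg hx.le, Real.norm_of_nonneg hn0.le, Real.exp_neg] at h
    rw [Real.le_log_iff_exp_le (by positivity), le_div_iff₀ hx]
    have := mul_le_mul_of_nonneg_left h (Real.exp_pos T).le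
    rwa [← mul_assoc, mul_inv_cancel₀ (Real.exp_pos T).ne', one_mul] at this
  have hR := hlogT K hk0 e6
  have hLam := hlogT K' hk0' e7
  have hquart : ∀ x : ℝ, 0 < x → ‖x‖ ≤ Real.exp (-T) * ‖(n:ℝ)‖ → x ≤ n / 4 := by
    intro x hx h
    rw [Real.norm_of_nonneg hx.le, Real.norm_of_nonneg hn0.le] at h
    have h4 : Real.exp (-T) ≤ 1 / 4 := by
      rw [Real.exp_neg, inv_le_comm₀ (Real.exp_pos T) (by norm_num)]
      have := Real.add_one_le_exp T
      norm_num
      linarith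
    nlinarith
  have h2 : 2 * (K + K') ≤ n := by
    have h3 := hquart K hk0 e6
    have h4 := hquart K' hk0' e7
    have : 2 * ((K:ℝ) + K') ≤ n := by linarith
    exact_mod_cast this
  have hmin : L ≤ 1 / 2 * min 1 ((K:ℝ) / (√n * Real.log n)) := by
    rwa [Real.norm_of_nonneg hl.le, Real.norm_of_nonneg (by positivity)] at e2
  have hm1 := min_le_left 1 ((K:ℝ) / (√n * Real.log n))
  have hm2 := min_le_right 1 ((K:ℝ) / (√n * Real.log n))
  have hm0 : 0 ≤ min 1 ((K:ℝ) / (√n * Real.log n)) := by positivity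
  have hR0 : 0 < Real.log ((n:ℝ) / K) := by linarith
  rw [Real.norm_of_nonneg (by positivity), Real.norm_of_nonneg hl.le] at e1
  have e3' := (Real.le_norm_self _).trans e3
  rw [Real.norm_of_nonneg hk0'.le] at e3' e4 e5
  rw [Real.norm_of_nonneg (by positivity)] at e4 e5
  obtain ⟨s, q, M, hM, hq, hs, hs2, hlc1, hlc2, hqL, hlek, hlek', hlcq⟩ :=
    facts (n := n) (k := K) (k' := K') (lam := L) e8 e9 h2 hl (by linarith) (by linarith) hLn
      (by linarith) (by linarith) (by linarith) e4 (by linarith) (by linarith)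
  generalize ellCrit n K K' L = lc at *
  have hcT : 128 ≤ c * Real.log ((n:ℝ) / K') := by
    have : 128 / c ≤ Real.log ((n:ℝ) / K') := hT2.trans hLam
    rw [div_le_iff₀ hc0] at this
    linarith
  have hq0 : 1600 ≤ q := by linarith
  have hcq : 32 ≤ c * q := by
    have : c * (Real.log ((n:ℝ) / K') / 4) ≤ c * q := by gcongr
    linarith
  have hlc0 : 800 ≤ lc := by linarith
  have hclc : 1 ≤ c * lc := by
    have : c * (q / 2) ≤ c * lc := by gcongr
    linarith
  have hlk : ∀ l : ℕ, (l:ℝ) ≤ 200 * lc → 2 * l ≤ K ∧ 2 * l ≤ K' := by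
    intro l h
    constructor
    · have : 2 * (l:ℝ) ≤ K := by linarith
      exact_mod_cast this
    · have : 2 * (l:ℝ) ≤ K' := by linarith
      exact_mod_cast this
  have hp1 : gammaCurve n K K' L (K' * K / n) ≤
      gammaCurve n K K' L ⌊(1 - δ) * lc⌋₊ - 1 * ((K':ℝ) * K / (L * n)) := by
    have hfl : ((⌊(1 - δ) * lc⌋₊ : ℕ) : ℝ) ≤ (1 - δ) * lc := Nat.floor_le (by
      apply mul_nonneg <;> linarith)
    have hfg := Nat.lt_floor_add_one ((1 - δ) * lc)
    have hle : ((⌊(1 - δ) * lc⌋₊ : ℕ) : ℝ) ≤ lc := by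
      have : 0 ≤ δ * lc := mul_nonneg (by linarith) (by linarith)
      linarith
    have hge : c * lc ≤ ((⌊(1 - δ) * lc⌋₊ : ℕ) : ℝ) := by
      have : (2 * c) * lc ≤ (1 - δ) * lc := by
        gcongr
        rw [hc]; linarith
      linarith
    generalize ⌊(1 - δ) * lc⌋₊ = l at *
    obtain ⟨g1, g2⟩ := hlk l (by linarith)
    have hl0 : 0 < l := by
      have : (0:ℝ) < l := by linarith
      exact_mod_cast this
    refine part1 e8 e9 h2 hl rfl (by linarith) hM hq hs hs2 hlc1 hlc2 hc0 (by linarith) ?_ ?_ hl0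
      (by omega) (by omega) hle hge
    · have := Real.exp_one_lt_d9
      linarith
    · have : 32 * q ≤ (c * q) * q := by gcongr
      have e : c * q ^ 2 = (c * q) * q := by ring
      rw [e]
      linarith
  have hp2 : gammaCurve n K K' L (100 * ⌈lc⌉₊) ≤ gammaCurve n K K' L (K' * K / n) := by
    have hcl := Nat.le_ceil lc
    have hcu := Nat.ceil_lt_add_one (by linarith : 0 ≤ lc)
    generalize ⌈lc⌉₊ = m at *
    have hle : ((100 * m : ℕ) : ℝ) ≤ 200 * lc := by push_cast; linarith
    have hge : 100 * lc ≤ ((100 * m : ℕ) : ℝ) := by push_cast; linarith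
    obtain ⟨g1, g2⟩ := hlk _ hle
    have hl0 : 0 < 100 * m := by
      have : (0:ℝ) < ((100 * m : ℕ) : ℝ) := by linarith
      exact_mod_cast this
    exact part2 e8 e9 h2 hl rfl (by linarith) hM hq hs hs2 hlc1 hlc2 hq0 hl0 g1 g2 hle hge
  exact max_le hp1 (hp2.trans hp1)
end
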